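/- Let G be an isometric multiple HNN extension of a finitely presented base group (A,X) (i.e., the associated subgroups U_i, V_i are finitely generated free, totally geodesic, and strip equidistant). If (A,X) has the synchronous falsification by fellow traveler property, then G is almost convex with respect to the generating set X ∪ {s_1, …, s_n}. -/

import Mathlib

/-!  Common framework: words over an inverse-closed generating set, word length,
geodesics, falsification by fellow traveler property, almost convexity. -/

namespace ACPaper

section Core

variable {β G : Type*} [Group G]

/-- A letter is a generator (`Sum.inl`) or the formal inverse of a generator (`Sum.inr`);
this realizes the inverse-closed alphabet `X^{±1}`. -/
def letterEval (gen : β → G) : β ⊕ β → G :=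
  Sum.elim gen fun b => (gen b)⁻¹

/-- Evaluation of a word over `X^{±1}` in the group. -/
def eval (gen : β → G) (w : List (β ⊕ β)) : G :=
  (w.map (letterEval gen)).prod

/-- `gen` is a generating set: every element is represented by some word. -/
def Generates (gen : β → G) : Prop :=
  ∀ g : G, ∃ w : List (β ⊕ β), eval gen w = g

/-- Word length of a group element with respect to the generating set. -/
noncomputable def wlen (gen : β → G) (g : G) : ℕ :=
  sInf {n : ℕ | ∃ w : List (β ⊕ β), eval gen w = g ∧ w.length = n}

/-- A word is geodesic if its length equals the word length of the element it represents. -/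
def IsGeodesic (gen : β → G) (w : List (β ⊕ β)) : Prop :=
  w.length = wlen gen (eval gen w)

/-- The point reached after `t` steps along the unit-speed path labelled by `w`
(the path remains at its endpoint after time `w.length`). -/
def pos (gen : β → G) (w : List (β ⊕ β)) (t : ℕ) : G :=
  eval gen (w.take t)

/-- Synchronous falsification by fellow traveler property with constant `k`:
every non-geodesic word is synchronously `k`-fellow traveled by a shorter word
representing the same element. -/
def SynchFFTP (gen : β → G) (k : ℕ) : Prop :=
  ∀ w : List (β ⊕ β), ¬ IsGeodesic gen w →
    ∃ w' : List (β ⊕ β), eval gen w' = eval gen w ∧ w'.length < w.length ∧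
      ∀ t : ℕ, wlen gen ((pos gen w t)⁻¹ * pos gen w' t) ≤ k

/-- The path starting at `g` labelled by the word `w` stays in the ball of radius `N`
about the identity. -/
def PathInBall (gen : β → G) (N : ℕ) (g : G) (w : List (β ⊕ β)) : Prop :=
  ∀ t : ℕ, wlen gen (g * pos gen w t) ≤ N

/-- Almost convexity with constant `C`: any two elements of the sphere of radius `N ≥ 1`
at distance at most `2` are joined by a path of length at most `C` inside the ball of
radius `N`. -/
def AlmostConvexWith (gen : β → G) (C : ℕ) : Prop :=
  ∀ N : ℕ, 1 ≤ N → ∀ g g' : G, wlen gen g = N → wlen gen g' = N →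
    wlen gen (g⁻¹ * g') ≤ 2 →
    ∃ w : List (β ⊕ β), g * eval gen w = g' ∧ w.length ≤ C ∧ PathInBall gen N g w

/-- Almost convexity: almost convex with some positive constant. -/
def AlmostConvex (gen : β → G) : Prop :=
  ∃ C : ℕ, 0 < C ∧ AlmostConvexWith gen C


end Core

/-- Two letters are an inverse pair (`x` followed by `x⁻¹`, or `x⁻¹` followed by `x`). -/
def IsInvPair {β : Type*} : β ⊕ β → β ⊕ β → Prop
  | Sum.inl x, Sum.inr y => x = y
  | Sum.inr x, Sum.inl y => x = y
  | _, _ => False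

/-- A word over a formal alphabet `κ^{±1}` is freely reduced. -/
def FreelyReduced {κ : Type*} (l : List (κ ⊕ κ)) : Prop :=
  l.Chain' fun a b => ¬ IsInvPair a b

/-- Every geodesic word (over `X^{±1}`) representing an element of the subgroup generated
by `gens` is a concatenation of geodesic words, each representing an element of `gens` or
an inverse of one. -/
def TGConcat {β G : Type*} [Group G] (gen : β → G) (gens : Set G) : Prop :=
  ∀ w : List (β ⊕ β), IsGeodesic gen w → eval gen w ∈ Subgroup.closure gens →
    ∃ ps : List (List (β ⊕ β)), w = ps.flatten ∧
      ∀ p ∈ ps, IsGeodesic gen p ∧ ∃ g ∈ gens, eval gen p = g ∨ eval gen p = g⁻¹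

/-- Every freely reduced word in the elements `f j` and their inverses, read as a word over
`X^{±1}` (i.e. substituting geodesic representatives), is geodesic: the word length of the
element it represents is the sum of the word lengths of its letters. -/
def TGReducedGeodesic {β G κ : Type*} [Group G] (gen : β → G) (f : κ → G) : Prop :=
  ∀ l : List (κ ⊕ κ), FreelyReduced l →
    wlen gen (eval f l) =
      (l.map (Sum.elim (fun j => wlen gen (f j)) fun j => wlen gen (f j))).sum

/-- The subgroup generated by the family `f` is totally geodesic in `(G, gen)`. -/
def TotallyGeodesicSub {β G κ : Type*} [Group G] (gen : β → G) (f : κ → G) : Prop :=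
  TGConcat gen (Set.range f) ∧ TGReducedGeodesic gen f

/-- The data of a multiple HNN extension: a finitely generated base group
`A = ⟨X ∣ R⟩` and, for each stable letter `s_i` (`i ∈ Fin n`), words
`uw i j, vw i j` over `X` spelling the generators `u_{ij}` of `U_i` and
`v_{ij} = φ_i(u_{ij})` of `V_i`. -/
structure MHNNData where
  /-- the generating set of the base group -/
  X : Type
  /-- the generating set is finite -/
  fin : Fintype X
  /-- the relators of the base group -/
  R : Set (FreeGroup X)
  /-- the number of stable letters -/
  n : ℕ
  /-- the number of free generators of each associated subgroup -/
  m : Fin n → ℕ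
  /-- words spelling the free generators of the `U_i` -/
  uw : (i : Fin n) → Fin (m i) → FreeGroup X
  /-- words spelling the free generators of the `V_i` -/
  vw : (i : Fin n) → Fin (m i) → FreeGroup X

namespace MHNNData

variable (D : MHNNData)

/-- The base group `A = ⟨X ∣ R⟩`. -/
def A : Type := PresentedGroup D.R

instance : Group D.A := by unfold A; infer_instance

/-- The canonical projection `FreeGroup X → A`. -/
def projA : FreeGroup D.X →* D.A := PresentedGroup.mk D.R

/-- The marking of the base group by its generators. -/
def genA : D.X → D.A := fun x => PresentedGroup.of x

/-- The free generators `u_{ij}` of the associated subgroup `U_i`. -/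
def u (i : Fin D.n) (j : Fin (D.m i)) : D.A := D.projA (D.uw i j)

/-- The free generators `v_{ij} = φ_i(u_{ij})` of the associated subgroup `V_i`. -/
def v (i : Fin D.n) (j : Fin (D.m i)) : D.A := D.projA (D.vw i j)

/-- The associated subgroup `U_i`. -/
def U (i : Fin D.n) : Subgroup D.A := Subgroup.closure (Set.range (D.u i))

/-- The associated subgroup `V_i`. -/
def V (i : Fin D.n) : Subgroup D.A := Subgroup.closure (Set.range (D.v i))

/-- The relators of the multiple HNN extension
`G = ⟨X, s_1, …, s_n ∣ R, s_i⁻¹ u_{ij} s_i = v_{ij}⟩`. -/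
def relsG : Set (FreeGroup (D.X ⊕ Fin D.n)) :=
  FreeGroup.map Sum.inl '' D.R ∪
    { r | ∃ (i : Fin D.n) (j : Fin (D.m i)),
        r = (FreeGroup.of (Sum.inr i))⁻¹ * FreeGroup.map Sum.inl (D.uw i j) *
            FreeGroup.of (Sum.inr i) * (FreeGroup.map Sum.inl (D.vw i j))⁻¹ }

/-- The multiple HNN extension `G`. -/
def G : Type := PresentedGroup D.relsG

instance : Group D.G := by unfold G; infer_instance

/-- The marking of `G` by the generating set `X ∪ {s_1, …, s_n}`. -/
def genG : D.X ⊕ Fin D.n → D.G := fun x => PresentedGroup.of x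

/-- Each associated subgroup `U_i`, `V_i` is free with the given (finite) free basis:
the induced maps from the free group are injective. -/
def FreeBases : Prop :=
  ∀ i : Fin D.n,
    Function.Injective (FreeGroup.lift (D.u i) : FreeGroup (Fin (D.m i)) →* D.A) ∧
    Function.Injective (FreeGroup.lift (D.v i) : FreeGroup (Fin (D.m i)) →* D.A)

/-- All associated subgroups are totally geodesic. -/
def TotallyGeodesic : Prop :=
  ∀ i : Fin D.n,
    TotallyGeodesicSub D.genA (D.u i) ∧ TotallyGeodesicSub D.genA (D.v i)

/-- The presentation is strip equidistant: `|u_{ij}| = |v_{ij}|` in `(A,X)`. -/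
def StripEquidistant : Prop :=
  ∀ (i : Fin D.n) (j : Fin (D.m i)), wlen D.genA (D.u i j) = wlen D.genA (D.v i j)

/-- `G` is an isometric multiple HNN extension: the associated subgroups are finitely
generated free, totally geodesic, and strip equidistant. -/
def IsIsometric : Prop :=
  D.FreeBases ∧ D.TotallyGeodesic ∧ D.StripEquidistant

end MHNNData

section Britton

variable {ι A Γ Γ' : Type} [Group A] [Group Γ] [Group Γ']

/-- The product `a₀ σ₁ a₁ σ₂ a₂ ⋯` in a group containing base elements (via `f`) and stable
letters (via `s`). -/
def hnnProd (f : A →* Γ) (s : ι → Γ) (a : A) (l : List ((ι ⊕ ι) × A)) : Γ :=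
  f a * (l.map fun p => letterEval s p.1 * f p.2).prod

/-- A list of syllables is reduced if it has no pinch `σ a σ⁻¹` with `a ∈ sub σ`. -/
def BrittonReduced (sub : ι ⊕ ι → Subgroup A) (l : List ((ι ⊕ ι) × A)) : Prop :=
  l.IsChain fun p q => ¬ (q.1 = p.1.swap ∧ p.2 ∈ sub p.1)

@[simp] lemma hnnProd_nil (f : A →* Γ) (s : ι → Γ) (a : A) : hnnProd f s a [] = f a := by
  simp [hnnProd]

lemma hnnProd_cons (f : A →* Γ) (s : ι → Γ) (a : A) (p : (ι ⊕ ι) × A)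
    (l : List ((ι ⊕ ι) × A)) :
    hnnProd f s a (p :: l) = f a * letterEval s p.1 * hnnProd f s p.2 l := by
  simp [hnnProd, mul_assoc]

/-- Britton's lemma for a family of stable letters indexed by `ι`, in existential form. -/
def HasBritton (A : Type) [Group A] (ι : Type) : Prop :=
  ∀ (U V : ι → Subgroup A) (φ : ∀ i, V i ≃* U i),
    ∃ (Γ : Type) (_ : Group Γ) (f : A →* Γ) (s : ι → Γ), Function.Injective f ∧
      (∀ i (a : V i), s i * f a * (s i)⁻¹ = f (φ i a)) ∧
      ∀ (a : A) (l : List ((ι ⊕ ι) × A)), BrittonReduced (Sum.elim V U) l →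
        hnnProd f s a l ∈ f.range → l = []

/-- Group the letters different from `none` into elements of the intermediate group. -/
def collapse (f : A →* Γ) (s : ι → Γ) :
    A → List ((Option ι ⊕ Option ι) × A) → Γ × List (ℤˣ × Γ)
  | a, [] => (f a, [])
  | a, (Sum.inl none, b) :: l => (f a, (1, (collapse f s b l).1) :: (collapse f s b l).2)
  | a, (Sum.inr none, b) :: l => (f a, (-1, (collapse f s b l).1) :: (collapse f s b l).2)
  | a, (Sum.inl (some i), b) :: l => (f a * s i * (collapse f s b l).1, (collapse f s b l).2)
  | a, (Sum.inr (some i), b) :: l => (f a * (s i)⁻¹ * (collapse f s b l).1, (collapse f s b l).2)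

/-- The maximal prefix without the letter `none`. -/
def stem : List ((Option ι ⊕ Option ι) × A) → List ((ι ⊕ ι) × A)
  | (Sum.inl (some i), b) :: l => (Sum.inl i, b) :: stem l
  | (Sum.inr (some i), b) :: l => (Sum.inr i, b) :: stem l
  | _ => []

lemma collapse_fst (f : A →* Γ) (s : ι → Γ) (a : A) (l : List ((Option ι ⊕ Option ι) × A)) :
    (collapse f s a l).1 = hnnProd f s a (stem l) := by
  induction l generalizing a with
  | nil => simp [collapse, stem]
  | cons p l ih =>
    obtain ⟨(_ | i) | (_ | i), b⟩ := p <;>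
      simp [collapse, stem, hnnProd_cons, letterEval, ih]

lemma stem_reduced {U V : Option ι → Subgroup A} {l : List ((Option ι ⊕ Option ι) × A)}
    (h : BrittonReduced (Sum.elim V U) l) :
    BrittonReduced (Sum.elim (fun i => V (some i)) fun i => U (some i)) (stem l) := by
  induction l with
  | nil => simp [stem, BrittonReduced]
  | cons p l ih =>
    have ih := ih h.of_cons
    obtain ⟨(_ | i) | (_ | i), b⟩ := p <;> simp only [stem]
    · exact List.isChain_nil
    · rcases l with _ | ⟨⟨(_ | i') | (_ | i'), b'⟩, l⟩ <;>
        simp_all [stem, BrittonReduced, List.isChain_cons_cons]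
    · exact List.isChain_nil
    · rcases l with _ | ⟨⟨(_ | i') | (_ | i'), b'⟩, l⟩ <;>
        simp_all [stem, BrittonReduced, List.isChain_cons_cons]

lemma collapse_prod (f : A →* Γ) (s : ι → Γ) (g : Γ →* Γ') (t : Γ') (a : A)
    (l : List ((Option ι ⊕ Option ι) × A)) :
    g (collapse f s a l).1 * ((collapse f s a l).2.map fun x => t ^ (x.1 : ℤ) * g x.2).prod =
      hnnProd (g.comp f) (fun i => i.elim t fun i => g (s i)) a l := by
  induction l generalizing a with
  | nil => simp [collapse]
  | cons p l ih =>
    obtain ⟨(_ | i) | (_ | i), b⟩ := p <;>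
      simp [collapse, hnnProd_cons, letterEval, ← ih, mul_assoc]

lemma eq_nil_of_collapse {f : A →* Γ} {s : ι → Γ} {a : A}
    {l : List ((Option ι ⊕ Option ι) × A)} (h1 : stem l = []) (h2 : (collapse f s a l).2 = []) :
    l = [] := by
  rcases l with _ | ⟨⟨(_ | i) | (_ | i), b⟩, l⟩ <;> simp_all [stem, collapse]

lemma collapse_chain {U V : Option ι → Subgroup A} {f : A →* Γ} {s : ι → Γ}
    (hf : Function.Injective f)
    (hb : ∀ (a : A) (l : List ((ι ⊕ ι) × A)),
      BrittonReduced (Sum.elim (fun i => V (some i)) fun i => U (some i)) l →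
        hnnProd f s a l ∈ f.range → l = [])
    {l : List ((Option ι ⊕ Option ι) × A)} (h : BrittonReduced (Sum.elim V U) l) (a : A) :
    (collapse f s a l).2.IsChain fun p q =>
      p.2 ∈ HNNExtension.toSubgroup ((V none).map f) ((U none).map f) p.1 → p.1 = q.1 := by
  have key : ∀ (W : Subgroup A) (b : A) (l : List ((Option ι ⊕ Option ι) × A)),
      BrittonReduced (Sum.elim V U) l → (collapse f s b l).1 ∈ W.map f → stem l = [] ∧ b ∈ W := by
    rintro W b l hl ⟨c, hc, hcb⟩
    rw [collapse_fst] at hcb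
    have h0 := hb b (stem l) (stem_reduced hl) ⟨c, hcb⟩
    refine ⟨h0, ?_⟩
    rw [h0, hnnProd_nil] at hcb
    exact hf hcb ▸ hc
  induction l generalizing a with
  | nil => exact List.isChain_nil
  | cons p l ih =>
    have ih := ih h.of_cons
    obtain ⟨(_ | i) | (_ | i), b⟩ := p <;> simp only [collapse]
    · refine List.isChain_cons.2 ⟨?_, ih b⟩
      intro q hq hmem
      obtain ⟨h1, h2⟩ := key _ _ _ h.of_cons hmem
      clear ih hb key hmem
      rcases l with _ | ⟨⟨(_ | i) | (_ | i), b'⟩, l⟩ <;> simp only [stem, collapse] at h1 hq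
      all_goals simp [BrittonReduced, List.isChain_cons_cons, h2] at h h1 hq
      all_goals simp [← hq]
    · exact ih b
    · refine List.isChain_cons.2 ⟨?_, ih b⟩
      intro q hq hmem
      obtain ⟨h1, h2⟩ := key _ _ _ h.of_cons hmem
      clear ih hb key hmem
      rcases l with _ | ⟨⟨(_ | i) | (_ | i), b'⟩, l⟩ <;> simp only [stem, collapse] at h1 hq
      all_goals simp [BrittonReduced, List.isChain_cons_cons, h2] at h h1 hq
      all_goals simp [← hq]
    · exact ih b

lemma HasBritton.option (h : HasBritton A ι) : HasBritton A (Option ι) := by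
  intro U V φ
  obtain ⟨Γ, _, f, s, hf, hs, hb⟩ := h (fun i => U (some i)) (fun i => V (some i)) fun i => φ _
  let φ' : (V none).map f ≃* (U none).map f :=
    ((V none).equivMapOfInjective f hf).symm.trans
      ((φ none).trans ((U none).equivMapOfInjective f hf))
  have hinj := HNNExtension.of_injective (φ := φ')
  refine ⟨HNNExtension Γ _ _ φ', inferInstance, HNNExtension.of.comp f,
    fun i => i.elim HNNExtension.t fun i => HNNExtension.of (s i), hinj.comp hf, ?_, ?_⟩
  · rintro (_ | i) a
    · have := HNNExtension.equiv_eq_conj (φ := φ') ((V none).equivMapOfInjective f hf a)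
      simp only [φ', MulEquiv.trans_apply, MulEquiv.symm_apply_apply,
        Subgroup.coe_equivMapOfInjective_apply] at this
      exact this.symm
    · simp [← hs]
  · intro a l hl hmem
    have h1 := collapse_chain hf hb hl a
    rw [← collapse_prod] at hmem
    obtain ⟨c, hc⟩ := hmem
    have h2 := HNNExtension.ReducedWord.toList_eq_nil_of_mem_of_range φ'
      ⟨(collapse f s a l).1, (collapse f s a l).2, h1⟩ ⟨f c, hc⟩
    dsimp only at h2
    rw [h2] at hc
    simp only [MonoidHom.comp_apply, List.map_nil, List.prod_nil, mul_one] at hc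
    refine eq_nil_of_collapse (hb a _ (stem_reduced hl) ⟨c, ?_⟩) h2
    rw [← collapse_fst, hinj hc]

lemma HasBritton.of_equiv {κ : Type} (e : ι ≃ κ) (h : HasBritton A ι) : HasBritton A κ := by
  intro U V φ
  obtain ⟨Γ, _, f, s, hf, hs, hb⟩ := h (U ∘ e) (V ∘ e) fun i => φ (e i)
  refine ⟨Γ, inferInstance, f, s ∘ e.symm, hf, ?_, ?_⟩
  · intro k a
    obtain ⟨i, rfl⟩ := e.surjective k
    simp [hs]
  · intro a l hl hmem
    have := hb a (l.map (Prod.map (Sum.map e.symm e.symm) id)) ?_ ?_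
    · simpa using this
    · unfold BrittonReduced at hl ⊢
      rw [List.isChain_map]
      refine hl.imp ?_
      rintro ⟨i | i, x⟩ ⟨j | j, y⟩ <;> simp
    · convert hmem using 1
      simp only [hnnProd, List.map_map]
      congr 3
      funext ⟨i, x⟩
      rcases i with i | i <;> simp [letterEval]

/-- Britton's lemma holds for every finite family of stable letters. -/
theorem hasBritton (A : Type) [Group A] (ι : Type) [Finite ι] : HasBritton A ι := by
  refine Finite.induction_empty_option (P := HasBritton A) (fun e h => h.of_equiv e) ?_
    (fun h => h.option) ι
  intro U V φ
  refine ⟨A, inferInstance, MonoidHom.id A, fun i => i.elim, Function.injective_id,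
    fun i => i.elim, ?_⟩
  rintro a (_ | ⟨⟨i | i, b⟩, l⟩) - -
  · rfl
  · exact i.elim
  · exact i.elim

end Britton

section Words

variable {β G : Type*} [Group G] {gen : β → G}

@[simp] lemma eval_nil : eval gen [] = 1 := rfl

@[simp] lemma eval_cons (y : β ⊕ β) (w : List (β ⊕ β)) :
    eval gen (y :: w) = letterEval gen y * eval gen w := by
  simp [eval]

@[simp] lemma eval_append (w w' : List (β ⊕ β)) :
    eval gen (w ++ w') = eval gen w * eval gen w' := by
  simp [eval]

@[simp] lemma letterEval_swap (y : β ⊕ β) : letterEval gen y.swap = (letterEval gen y)⁻¹ := by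
  rcases y with y | y <;> simp [letterEval]

/-- The formal inverse of a word. -/
def winv (w : List (β ⊕ β)) : List (β ⊕ β) := (w.map Sum.swap).reverse

@[simp] lemma winv_nil : winv ([] : List (β ⊕ β)) = [] := rfl

lemma winv_cons (y : β ⊕ β) (w : List (β ⊕ β)) : winv (y :: w) = winv w ++ [y.swap] := by
  simp [winv]

lemma winv_append (w w' : List (β ⊕ β)) : winv (w ++ w') = winv w' ++ winv w := by
  simp [winv]

@[simp] lemma length_winv (w : List (β ⊕ β)) : (winv w).length = w.length := by
  simp [winv]

@[simp] lemma eval_winv (w : List (β ⊕ β)) : eval gen (winv w) = (eval gen w)⁻¹ := by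
  induction w with
  | nil => simp
  | cons y w ih => simp [winv_cons, ih]

lemma wlen_eval_le (w : List (β ⊕ β)) : wlen gen (eval gen w) ≤ w.length :=
  Nat.sInf_le ⟨w, rfl, rfl⟩

lemma exists_word_of_generates {g : G} (h : ∃ w, eval gen w = g) :
    ∃ w, eval gen w = g ∧ w.length = wlen gen g := by
  obtain ⟨w, hw⟩ := h
  exact Nat.sInf_mem (s := {n : ℕ | ∃ w : List (β ⊕ β), eval gen w = g ∧ w.length = n})
    ⟨_, w, hw, rfl⟩

@[simp] lemma wlen_one : wlen gen (1 : G) = 0 :=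
  Nat.le_zero.1 (wlen_eval_le (gen := gen) [])

lemma wlen_letterEval_le (y : β ⊕ β) : wlen gen (letterEval gen y) ≤ 1 := by
  simpa using wlen_eval_le (gen := gen) [y]

lemma wlen_mul_le (hg : Generates gen) (a b : G) :
    wlen gen (a * b) ≤ wlen gen a + wlen gen b := by
  obtain ⟨w, rfl, hw⟩ := exists_word_of_generates (hg a)
  obtain ⟨w', rfl, hw'⟩ := exists_word_of_generates (hg b)
  rw [← hw, ← hw', ← eval_append, ← List.length_append]
  exact wlen_eval_le _

lemma wlen_inv_le (hg : Generates gen) (a : G) : wlen gen a⁻¹ ≤ wlen gen a := by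
  obtain ⟨w, rfl, hw⟩ := exists_word_of_generates (hg a)
  rw [← hw, ← eval_winv, ← length_winv w]
  exact wlen_eval_le _

lemma wlen_inv (hg : Generates gen) (a : G) : wlen gen a⁻¹ = wlen gen a :=
  le_antisymm (wlen_inv_le hg a) (by simpa using wlen_inv_le hg a⁻¹)

lemma isGeodesic_iff {w : List (β ⊕ β)} :
    IsGeodesic gen w ↔ ∀ w', eval gen w' = eval gen w → w.length ≤ w'.length := by
  constructor
  · intro h w' hw'
    rw [h, ← hw']
    exact wlen_eval_le _
  · intro h
    obtain ⟨w', hw', hl⟩ := exists_word_of_generates (gen := gen) ⟨w, rfl⟩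
    exact le_antisymm (hl ▸ h w' hw') (wlen_eval_le _)

lemma IsGeodesic.of_append_append {a b c : List (β ⊕ β)} (h : IsGeodesic gen (a ++ b ++ c)) :
    IsGeodesic gen b := by
  rw [isGeodesic_iff] at h ⊢
  intro b' hb'
  have := h (a ++ b' ++ c) (by simp [hb'])
  simp only [List.length_append] at this
  omega

lemma IsGeodesic.right {a b : List (β ⊕ β)} (h : IsGeodesic gen (a ++ b)) :
    IsGeodesic gen b :=
  IsGeodesic.of_append_append (a := a) (c := []) (by simpa using h)

lemma IsGeodesic.winv {w : List (β ⊕ β)} (h : IsGeodesic gen w) : IsGeodesic gen (winv w) := by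
  rw [isGeodesic_iff] at h ⊢
  intro w' hw'
  simpa using h (ACPaper.winv w') (by simp [hw'])

lemma pos_zero (w : List (β ⊕ β)) : pos gen w 0 = 1 := rfl

lemma pos_of_length_le {w : List (β ⊕ β)} {t : ℕ} (h : w.length ≤ t) :
    pos gen w t = eval gen w := by
  rw [pos, List.take_of_length_le h]

lemma pos_append_left {w w' : List (β ⊕ β)} {t : ℕ} (h : t ≤ w.length) :
    pos gen (w ++ w') t = pos gen w t := by
  rw [pos, List.take_append_of_le_length h, pos]

lemma pos_append_add (w w' : List (β ⊕ β)) (t : ℕ) :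
    pos gen (w ++ w') (w.length + t) = eval gen w * pos gen w' t := by
  simp [pos, List.take_length_add_append]

lemma pos_mul_eval_drop (w : List (β ⊕ β)) (t : ℕ) :
    pos gen w t * eval gen (w.drop t) = eval gen w := by
  rw [pos, ← eval_append, List.take_append_drop]

lemma wlen_pos_le (w : List (β ⊕ β)) (t : ℕ) : wlen gen (pos gen w t) ≤ t :=
  (wlen_eval_le _).trans (by simp)

lemma wlen_pos_step (w : List (β ⊕ β)) (t : ℕ) :
    wlen gen ((pos gen w t)⁻¹ * pos gen w (t + 1)) ≤ 1 := by
  rcases lt_or_ge t w.length with h | h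
  · have h1 : w.take (t + 1) = w.take t ++ [w[t]] := by simp
    rw [pos, pos, h1, eval_append]
    simpa using wlen_letterEval_le _
  · rw [pos_of_length_le h, pos_of_length_le (by omega)]
    simp

/-- `g` and `g'` are joined by a path of length at most `C` in the ball of radius `N`. -/
def Conn (gen : β → G) (N C : ℕ) (g g' : G) : Prop :=
  ∃ w : List (β ⊕ β), g * eval gen w = g' ∧ w.length ≤ C ∧ PathInBall gen N g w

lemma pathInBall_cons {N : ℕ} {g : G} {y : β ⊕ β} {w : List (β ⊕ β)} :
    PathInBall gen N g (y :: w) ↔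
      wlen gen g ≤ N ∧ PathInBall gen N (g * letterEval gen y) w := by
  constructor
  · intro h
    refine ⟨by simpa [pos] using h 0, fun t => ?_⟩
    simpa [pos, mul_assoc] using h (t + 1)
  · rintro ⟨h0, h⟩ (_ | t)
    · simpa [pos] using h0
    · simpa [pos, mul_assoc] using h t

lemma pathInBall_nil {N : ℕ} {g : G} : PathInBall gen N g [] ↔ wlen gen g ≤ N := by
  simp [PathInBall, pos]

lemma PathInBall.append {N : ℕ} {g : G} {w w' : List (β ⊕ β)} (h : PathInBall gen N g w)
    (h' : PathInBall gen N (g * eval gen w) w') : PathInBall gen N g (w ++ w') := by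
  induction w generalizing g with
  | nil => simpa using h'
  | cons y w ih =>
    rw [pathInBall_cons] at h
    rw [List.cons_append, pathInBall_cons]
    exact ⟨h.1, ih h.2 (by simpa [mul_assoc] using h')⟩

namespace Conn

variable {N C C' : ℕ} {g g' g'' : G}

lemma refl (h : wlen gen g ≤ N) : Conn gen N 0 g g :=
  ⟨[], by simp, le_rfl, pathInBall_nil.2 h⟩

lemma mono (h : Conn gen N C g g') (hC : C ≤ C') : Conn gen N C' g g' := by
  obtain ⟨w, h1, h2, h3⟩ := h
  exact ⟨w, h1, h2.trans hC, h3⟩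

lemma trans (h : Conn gen N C g g') (h' : Conn gen N C' g' g'') :
    Conn gen N (C + C') g g'' := by
  obtain ⟨w, rfl, h2, h3⟩ := h
  obtain ⟨w', rfl, h2', h3'⟩ := h'
  refine ⟨w ++ w', by simp [mul_assoc], ?_, h3.append h3'⟩
  rw [List.length_append]
  omega

lemma letter {y : β ⊕ β} (h : wlen gen g ≤ N) (h' : wlen gen (g * letterEval gen y) ≤ N) :
    Conn gen N 1 g (g * letterEval gen y) :=
  ⟨[y], by simp, le_rfl, pathInBall_cons.2 ⟨h, pathInBall_nil.2 h'⟩⟩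

lemma symm (h : Conn gen N C g g') : Conn gen N C g' g := by
  obtain ⟨w, rfl, h2, h3⟩ := h
  refine mono ?_ h2
  clear h2
  induction w generalizing g with
  | nil => simpa using refl (pathInBall_nil.1 h3)
  | cons y w ih =>
    rw [pathInBall_cons] at h3
    have h4 := ih h3.2
    have h5 : Conn gen N 1 (g * letterEval gen y) (g * letterEval gen y * letterEval gen y.swap) :=
      letter (by simpa [pos] using h3.2 0) (by simpa using h3.1)
    simpa [mul_assoc] using h4.trans h5

lemma jump (hg : Generates gen) {K : ℕ} (h : wlen gen g + K ≤ N)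
    (hK : wlen gen (g⁻¹ * g') ≤ K) : Conn gen N K g g' := by
  obtain ⟨w, hw, hl⟩ := exists_word_of_generates (hg (g⁻¹ * g'))
  refine ⟨w, by simp [hw], hl ▸ hK, fun t => ?_⟩
  have h1 := wlen_mul_le hg g (pos gen w t)
  have h2 : wlen gen (pos gen w t) ≤ w.length := (wlen_eval_le _).trans (by simp)
  omega

lemma step (hg : Generates gen) (h : wlen gen g ≤ N) (h' : wlen gen g' ≤ N)
    (hK : wlen gen (g⁻¹ * g') ≤ 1) : Conn gen N 1 g g' := by
  obtain ⟨w, hw, hl⟩ := exists_word_of_generates (hg (g⁻¹ * g'))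
  obtain rfl : g' = g * eval gen w := by simp [hw]
  rcases w with _ | ⟨y, _ | ⟨z, w⟩⟩
  · simpa using (refl h).mono (zero_le_one)
  · simpa using letter (y := y) h (by simpa using h')
  · simp only [List.length_cons] at hl
    omega

lemma walk (hg : Generates gen) {f : ℕ → G} (hf : ∀ t, wlen gen ((f t)⁻¹ * f (t + 1)) ≤ 1)
    {s s' : ℕ} (hs : s ≤ s') (hN : ∀ t, s ≤ t → t ≤ s' → wlen gen (f t) ≤ N) :
    Conn gen N (s' - s) (f s) (f s') := by
  induction s', hs using Nat.le_induction with
  | base => simpa using refl (hN s le_rfl le_rfl)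
  | succ m hm ih =>
    refine ((ih fun t h1 h2 => hN t h1 (by omega)).trans
      (step hg (hN m hm (by omega)) (hN (m + 1) (by omega) le_rfl) (hf m))).mono (by omega)

end Conn

end Words

section FreeWords

variable {β G κ : Type*} [Group G] {gen : β → G} {f h : κ → G}

lemma exists_eval_of_mem_closure {g : G} (hg : g ∈ Subgroup.closure (Set.range f)) :
    ∃ l, eval f l = g := by
  induction hg using Subgroup.closure_induction with
  | mem x hx =>
    obtain ⟨j, rfl⟩ := hx
    exact ⟨[Sum.inl j], by simp [letterEval]⟩
  | one => exact ⟨[], rfl⟩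
  | mul x y _ _ hx hy =>
    obtain ⟨a, rfl⟩ := hx
    obtain ⟨b, rfl⟩ := hy
    exact ⟨a ++ b, by simp⟩
  | inv x _ hx =>
    obtain ⟨a, rfl⟩ := hx
    exact ⟨winv a, by simp⟩

lemma IsGeodesic.freelyReduced {l : List (κ ⊕ κ)} (hl : IsGeodesic f l) : FreelyReduced l := by
  change l.IsChain _
  rw [List.isChain_iff_forall_rel_of_append_cons_cons]
  rintro a b l₁ l₂ rfl hab
  rw [isGeodesic_iff] at hl
  have h1 : letterEval f a * letterEval f b = 1 := by
    rcases a with a | a <;> rcases b with b | b <;> simp_all [IsInvPair, letterEval]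
  have := hl (l₁ ++ l₂) (by simp [← mul_assoc (letterEval f a), h1])
  simp at this

lemma exists_freelyReduced {g : G} (hg : g ∈ Subgroup.closure (Set.range f)) :
    ∃ l, eval f l = g ∧ FreelyReduced l := by
  obtain ⟨l, hl, hl'⟩ := exists_word_of_generates (exists_eval_of_mem_closure hg)
  refine ⟨l, hl, IsGeodesic.freelyReduced (f := f) ?_⟩
  rw [IsGeodesic, hl, hl']

lemma TGReducedGeodesic.wlen_eq (hf : TGReducedGeodesic gen f) (hh : TGReducedGeodesic gen h)
    (he : ∀ j, wlen gen (f j) = wlen gen (h j)) {l : List (κ ⊕ κ)} (hl : FreelyReduced l) :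
    wlen gen (eval f l) = wlen gen (eval h l) := by
  rw [hf l hl, hh l hl]
  simp only [he]

end FreeWords

section Fellow

variable {β A : Type*} [Group A] {gA : β → A}

lemma SynchFFTP.exists_fellow (hgA : Generates gA) {k : ℕ} (hk : SynchFFTP gA k)
    (W : List (β ⊕ β)) : ∃ W' : List (β ⊕ β), eval gA W' = eval gA W ∧ W'.length ≤ W.length ∧
      (∀ t, wlen gA ((pos gA W t)⁻¹ * pos gA W' t) ≤ 2 * k) ∧
      (W'.length + 2 ≤ W.length ∨ IsGeodesic gA W' ∧ W.length ≤ W'.length + 1) := by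
  by_cases h : IsGeodesic gA W
  · exact ⟨W, rfl, le_rfl, by simp, Or.inr ⟨h, by omega⟩⟩
  obtain ⟨W₁, he₁, hl₁, hf₁⟩ := hk W h
  by_cases hlen : W₁.length + 2 ≤ W.length
  · exact ⟨W₁, he₁, hl₁.le, fun t => (hf₁ t).trans (by omega), Or.inl hlen⟩
  by_cases h₁ : IsGeodesic gA W₁
  · exact ⟨W₁, he₁, hl₁.le, fun t => (hf₁ t).trans (by omega), Or.inr ⟨h₁, by omega⟩⟩
  obtain ⟨W₂, he₂, hl₂, hf₂⟩ := hk W₁ h₁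
  refine ⟨W₂, he₂.trans he₁, by omega, fun t => ?_, Or.inl (by omega)⟩
  have h1 := wlen_mul_le hgA ((pos gA W t)⁻¹ * pos gA W₁ t) ((pos gA W₁ t)⁻¹ * pos gA W₂ t)
  have h2 := hf₁ t
  have h3 := hf₂ t
  rw [show (pos gA W t)⁻¹ * pos gA W₁ t * ((pos gA W₁ t)⁻¹ * pos gA W₂ t) =
    (pos gA W t)⁻¹ * pos gA W₂ t by group] at h1
  omega

end Fellow

section Geometry

variable {β γ A G : Type*} [Group A] [Group G] {gA : β → A} {gG : γ → G}

/-- Conjugation by `c` carries the vertex at time `s` of the path `W` to that of `V`. -/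
def Cross (gA : β → A) (j : A →* G) (c : G) (W V : List (β ⊕ β)) (s : ℕ) : Prop :=
  c * j (pos gA W s) * c⁻¹ = j (pos gA V s)

/-- The path `V` is the mirror image of `W` under conjugation by `c`, up to subdivision of time
into intervals of length at most `R`. -/
def Mirror (gA : β → A) (j : A →* G) (c : G) (R : ℕ) (W V : List (β ⊕ β)) : Prop :=
  V.length = W.length ∧ ∀ τ ≤ W.length, ∃ s s', s ≤ τ ∧ τ ≤ s' ∧ s' ≤ W.length ∧ s' ≤ s + R ∧
    Cross gA j c W V s ∧ Cross gA j c W V s'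

lemma Mirror.cross_length {j : A →* G} {c : G} {R : ℕ} {W V : List (β ⊕ β)}
    (h : Mirror gA j c R W V) : c * j (eval gA W) * c⁻¹ = j (eval gA V) := by
  obtain ⟨s, s', -, h1, h2, -, -, h3⟩ := h.2 W.length le_rfl
  obtain rfl : s' = W.length := by omega
  rw [Cross, pos_of_length_le le_rfl, pos_of_length_le h.1.le] at h3
  exact h3

lemma exists_mirror {κ : Type*} (hgA : Generates gA) {f h : κ → A} {j : A →* G} {c : G} {R : ℕ}
    (hf : TGConcat gA (Set.range f)) (hfh : ∀ i, wlen gA (f i) = wlen gA (h i))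
    (hc : ∀ i, c * j (f i) * c⁻¹ = j (h i)) (hR : ∀ i, wlen gA (f i) ≤ R)
    {W : List (β ⊕ β)} (hW : IsGeodesic gA W)
    (hm : eval gA W ∈ Subgroup.closure (Set.range f)) :
    ∃ V, Mirror gA j c R W V := by
  obtain ⟨ps, rfl, hps⟩ := hf W hW hm
  clear hW hm hf
  induction ps with
  | nil => exact ⟨[], rfl, fun τ hτ => ⟨0, 0, by simp_all [Cross, pos_zero]⟩⟩
  | cons p ps ih =>
    obtain ⟨V, hV, hVc⟩ := ih fun q hq => hps q (List.mem_cons_of_mem _ hq)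
    obtain ⟨hp, g, ⟨i, rfl⟩, hpi⟩ := hps p List.mem_cons_self
    obtain ⟨q, hq, hqR, hqc⟩ : ∃ q : List (β ⊕ β), q.length = p.length ∧ p.length ≤ R ∧
        c * j (eval gA p) * c⁻¹ = j (eval gA q) := by
      rcases hpi with hpi | hpi
      · obtain ⟨q, hq, hl⟩ := exists_word_of_generates (hgA (h i))
        refine ⟨q, by rw [hl, hp, hpi, hfh], by rw [hp, hpi]; exact hR i, ?_⟩
        rw [hpi, hq, hc]
      · obtain ⟨q, hq, hl⟩ := exists_word_of_generates (hgA (h i)⁻¹)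
        refine ⟨q, by rw [hl, hp, hpi, wlen_inv hgA, wlen_inv hgA, hfh],
          by rw [hp, hpi, wlen_inv hgA]; exact hR i, ?_⟩
        rw [hpi, hq, map_inv, map_inv, ← hc]
        group
    have hshift : ∀ s, Cross gA j c ps.flatten V s →
        Cross gA j c (p :: ps).flatten (q ++ V) (p.length + s) := by
      intro s hs
      rw [Cross] at hs ⊢
      rw [List.flatten_cons, pos_append_add, ← hq, pos_append_add, map_mul, map_mul, ← hqc, ← hs]
      group
    refine ⟨q ++ V, by simp [hq, hV], fun τ hτ => ?_⟩
    rw [List.flatten_cons, List.length_append] at hτ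
    simp only [List.flatten_cons, List.length_append] at hshift ⊢
    rcases le_total τ p.length with hle | hle
    · refine ⟨0, p.length, by omega, hle, by omega, by omega, by simp [Cross, pos_zero], ?_⟩
      exact hshift 0 (by simp [Cross, pos_zero])
    · obtain ⟨s, s', h1, h2, h3, h4, h5, h6⟩ := hVc (τ - p.length) (by omega)
      exact ⟨p.length + s, p.length + s', by omega, by omega, by omega, by omega,
        hshift s h5, hshift s' h6⟩

section

variable (hgG : Generates gG) {j : A →* G} (hj : ∀ a, wlen gG (j a) ≤ wlen gA a)
include hgG hj

lemma wlen_path_le (p : G) (W : List (β ⊕ β)) (t : ℕ) :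
    wlen gG (p * j (pos gA W t)) ≤ wlen gG p + t :=
  (wlen_mul_le hgG _ _).trans (Nat.add_le_add_left ((hj _).trans (wlen_pos_le _ _)) _)

lemma wlen_path_le_end (p : G) (W : List (β ⊕ β)) (t : ℕ) :
    wlen gG (p * j (pos gA W t)) ≤ wlen gG (p * j (eval gA W)) + (W.length - t) := by
  have h1 : p * j (pos gA W t) = p * j (eval gA W) * j (eval gA (winv (W.drop t))) := by
    rw [← pos_mul_eval_drop W t, eval_winv, map_mul, map_inv]
    group
  rw [h1]
  refine (wlen_mul_le hgG _ _).trans (Nat.add_le_add_left ((hj _).trans ?_) _)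
  exact (wlen_eval_le _).trans (by simp)

lemma conn_path {N : ℕ} (p : G) (W : List (β ⊕ β)) {s s' : ℕ} (hs : s ≤ s')
    (hN : ∀ t, s ≤ t → t ≤ s' → wlen gG (p * j (pos gA W t)) ≤ N) :
    Conn gG N (s' - s) (p * j (pos gA W s)) (p * j (pos gA W s')) := by
  refine Conn.walk hgG (f := fun t => p * j (pos gA W t)) (fun t => ?_) hs hN
  refine le_trans ?_ ((hj _).trans (wlen_pos_step W t))
  simp [mul_assoc]

lemma conn_fellow {N K : ℕ} {p : G} {W W' : List (β ⊕ β)} {s : ℕ}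
    (hf : wlen gA ((pos gA W s)⁻¹ * pos gA W' s) ≤ K)
    (hN : wlen gG (p * j (pos gA W s)) + K ≤ N) :
    Conn gG N K (p * j (pos gA W s)) (p * j (pos gA W' s)) := by
  refine Conn.jump hgG hN (le_trans ?_ ((hj _).trans hf))
  simp [mul_assoc]

/-- The case of a path shorter by two that fellow travels the path over the top vertex. -/
lemma conn_of_shorter {p : G} {W W' : List (β ⊕ β)} {N K n₀ n₁ L L' : ℕ}
    (he : eval gA W' = eval gA W) (hl : W.length = L + L') (hl' : W'.length + 2 ≤ L + L')
    (hf : ∀ t, wlen gA ((pos gA W t)⁻¹ * pos gA W' t) ≤ K)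
    (h₀ : wlen gG p ≤ n₀) (h₁ : wlen gG (p * j (eval gA W)) ≤ n₁)
    (hL : 1 ≤ L) (hL' : 1 ≤ L') (hN : n₀ + L = N + 1) (hN' : n₁ + L' = N + 1) :
    Conn gG N (6 * K + 2) (p * j (pos gA W (L - 1))) (p * j (pos gA W (L + 1))) := by
  have hW := wlen_path_le hgG hj p W
  have hW' := wlen_path_le hgG hj p W'
  have hWe := wlen_path_le_end hgG hj p W
  have hWe' := wlen_path_le_end hgG hj p W'
  rw [he] at hWe'
  have c1 : Conn gG N K (p * j (pos gA W (L - 1))) (p * j (pos gA W (L - 1 - K))) := by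
    refine (conn_path hgG hj p W (s := L - 1 - K) (s' := L - 1) (by omega) fun t _ ht => ?_).symm.mono
      (by omega)
    have := hW t
    omega
  have c2 : Conn gG N K (p * j (pos gA W (L - 1 - K))) (p * j (pos gA W' (L - 1 - K))) := by
    rcases Nat.eq_zero_or_pos (L - 1 - K) with h | h
    · rw [h, pos_zero, pos_zero]
      refine (Conn.refl ?_).mono (Nat.zero_le _)
      simp only [map_one, mul_one]
      omega
    · refine conn_fellow hgG hj (hf _) ?_
      have := hW (L - 1 - K)
      omega
  have c3 : Conn gG N (2 * K + 2) (p * j (pos gA W' (L - 1 - K)))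
      (p * j (pos gA W' (L + 1 + K))) := by
    refine (conn_path hgG hj p W' (by omega) fun t _ ht => ?_).mono (by omega)
    have := hW' t
    have := hWe' t
    omega
  have c4 : Conn gG N K (p * j (pos gA W' (L + 1 + K))) (p * j (pos gA W (L + 1 + K))) := by
    rcases le_total W.length (L + 1 + K) with h | h
    · rw [pos_of_length_le h, pos_of_length_le (by omega), he]
      refine (Conn.refl ?_).mono (Nat.zero_le _)
      omega
    · refine (conn_fellow hgG hj (hf _) ?_).symm
      have := hWe (L + 1 + K)
      omega
  have c5 : Conn gG N K (p * j (pos gA W (L + 1 + K))) (p * j (pos gA W (L + 1))) := by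
    refine (conn_path hgG hj p W (by omega) fun t ht _ => ?_).symm.mono (by omega)
    have := hWe t
    omega
  exact (c1.trans (c2.trans (c3.trans (c4.trans c5)))).mono (by omega)

/-- The case of a fellow travelling geodesic running along a strip. -/
lemma conn_of_mirror {p c : G} {W W' V : List (β ⊕ β)} {N K R n₀ n₁ L L' : ℕ}
    (hm : Mirror gA j c R W' V) (hc : wlen gG c ≤ 1)
    (he : eval gA W' = eval gA W) (hl : W.length = L + L') (hle : W'.length ≤ W.length)
    (hl' : L + L' ≤ W'.length + 1)
    (hf : ∀ t, wlen gA ((pos gA W t)⁻¹ * pos gA W' t) ≤ K)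
    (h₀ : wlen gG (p * c) ≤ n₀) (h₀' : wlen gG p + 1 ≤ n₀)
    (h₁ : wlen gG (p * c * j (eval gA W)) ≤ n₁)
    (h₁' : wlen gG (p * c * j (eval gA W) * c⁻¹) + 1 ≤ n₁)
    (hL : 1 ≤ L) (hL' : 1 ≤ L') (hN : n₀ + L = N + 1) (hN' : n₁ + L' = N + 1) :
    Conn gG N (6 * K + 4 * R + 6) (p * c * j (pos gA W (L - 1)))
      (p * c * j (pos gA W (L + 1))) := by
  have hW := wlen_path_le hgG hj (p * c) W
  have hW' := wlen_path_le hgG hj (p * c) W'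
  have hWe := wlen_path_le_end hgG hj (p * c) W
  have hWe' := wlen_path_le_end hgG hj (p * c) W'
  rw [he] at hWe'
  have hV := wlen_path_le hgG hj p V
  have hVe := wlen_path_le_end hgG hj p V
  rw [show p * j (eval gA V) = p * c * j (eval gA W) * c⁻¹ by
    rw [← hm.cross_length, he]; group] at hVe
  have hVl := hm.1
  obtain ⟨s, s', a1, a2, a3, a4, a5, -⟩ := hm.2 (L - 1 - K) (by omega)
  obtain ⟨r, r', b1, b2, b3, b4, -, b6⟩ := hm.2 (min (L + 1 + K) W'.length) (by omega)
  have cross : ∀ t, Cross gA j c W' V t → wlen gG (p * c * j (pos gA W' t)) ≤ N →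
      wlen gG (p * j (pos gA V t)) ≤ N →
      Conn gG N 1 (p * c * j (pos gA W' t)) (p * j (pos gA V t)) := by
    intro t ht h1 h2
    refine Conn.step hgG h1 h2 ?_
    rw [← ht, show (p * c * j (pos gA W' t))⁻¹ * (p * (c * j (pos gA W' t) * c⁻¹)) = c⁻¹ by group,
      wlen_inv hgG]
    exact hc
  have c1 : Conn gG N (K + R) (p * c * j (pos gA W (L - 1))) (p * c * j (pos gA W s)) := by
    refine (conn_path hgG hj _ W (s := s) (s' := L - 1) (by omega) fun t _ ht => ?_).symm.mono
      (by omega)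
    have := hW t
    omega
  have c2 : Conn gG N K (p * c * j (pos gA W s)) (p * c * j (pos gA W' s)) := by
    rcases Nat.eq_zero_or_pos s with h | h
    · rw [h, pos_zero, pos_zero]
      refine (Conn.refl ?_).mono (Nat.zero_le _)
      simp only [map_one, mul_one]
      omega
    · refine conn_fellow hgG hj (hf _) ?_
      have := hW s
      omega
  have c3 : Conn gG N 1 (p * c * j (pos gA W' s)) (p * j (pos gA V s)) := by
    have := hW' s
    have := hV s
    exact cross s a5 (by omega) (by omega)
  have c4 : Conn gG N (2 * K + 2 * R + 2) (p * j (pos gA V s)) (p * j (pos gA V r')) := by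
    refine (conn_path hgG hj p V (by omega) fun t _ ht => ?_).mono (by omega)
    have := hV t
    have := hVe t
    omega
  have c5 : Conn gG N 1 (p * j (pos gA V r')) (p * c * j (pos gA W' r')) := by
    have := hV r'
    have := hVe r'
    have := hWe' r'
    exact (cross r' b6 (by omega) (by omega)).symm
  have c6 : Conn gG N (2 * K + R + 2) (p * c * j (pos gA W' r')) (p * c * j (pos gA W (L + 1))) := by
    rcases le_or_gt (L + 1 + K) r' with h | h
    · have d1 : Conn gG N (K + R) (p * c * j (pos gA W r')) (p * c * j (pos gA W (L + 1))) := by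
        refine (conn_path hgG hj _ W (by omega) fun t ht _ => ?_).symm.mono (by omega)
        have := hWe t
        omega
      have d2 : Conn gG N K (p * c * j (pos gA W' r')) (p * c * j (pos gA W r')) := by
        refine (conn_fellow hgG hj (hf _) ?_).symm
        have := hWe r'
        omega
      exact (d2.trans d1).mono (by omega)
    · have h' : r' = W'.length := by omega
      have d1 : Conn gG N (K + 1) (p * c * j (pos gA W (L + L')))
          (p * c * j (pos gA W (L + 1))) := by
        refine (conn_path hgG hj _ W (by omega) fun t ht _ => ?_).symm.mono (by omega)
        have := hWe t
        omega
      rw [pos_of_length_le hl.le, ← he, ← pos_of_length_le (gen := gA) h'.ge] at d1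
      exact d1.mono (by omega)
  exact (c1.trans (c2.trans (c3.trans (c4.trans (c5.trans c6))))).mono (by omega)

/-- The case of a geodesic running along a strip up to the top vertex. -/
lemma conn_of_mirror_end {p c : G} {W V : List (β ⊕ β)} {N R n₀ L : ℕ}
    (hm : Mirror gA j c R W V) (hc : wlen gG c ≤ 1) (hl : W.length = L)
    (h₀ : wlen gG (p * c) ≤ n₀) (h₀' : wlen gG p + 1 ≤ n₀)
    (hL : 1 ≤ L) (hN : n₀ + L = N + 1) :
    Conn gG N (2 * R + 2) (p * c * j (pos gA W (L - 1))) (p * c * j (eval gA W) * c⁻¹) := by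
  have hW := wlen_path_le hgG hj (p * c) W
  have hV := wlen_path_le hgG hj p V
  have hVl := hm.1
  obtain ⟨s, s', a1, a2, a3, a4, a5, -⟩ := hm.2 (L - 1) (by omega)
  have c1 : Conn gG N R (p * c * j (pos gA W (L - 1))) (p * c * j (pos gA W s)) := by
    refine (conn_path hgG hj _ W (s := s) (s' := L - 1) (by omega) fun t _ ht => ?_).symm.mono
      (by omega)
    have := hW t
    omega
  have c2 : Conn gG N 1 (p * c * j (pos gA W s)) (p * j (pos gA V s)) := by
    refine Conn.step hgG ?_ ?_ ?_
    · have := hW s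
      omega
    · have := hV s
      omega
    · rw [← a5, show (p * c * j (pos gA W s))⁻¹ * (p * (c * j (pos gA W s) * c⁻¹)) = c⁻¹ by group,
        wlen_inv hgG]
      exact hc
  have c3 : Conn gG N (R + 1) (p * j (pos gA V s)) (p * j (pos gA V L)) := by
    refine (conn_path hgG hj p V (by omega) fun t _ ht => ?_).mono (by omega)
    have := hV t
    omega
  rw [pos_of_length_le (hVl.trans hl).le, ← hm.cross_length,
    show p * (c * j (eval gA W) * c⁻¹) = p * c * j (eval gA W) * c⁻¹ by group] at c3
  exact (c1.trans (c2.trans c3)).mono (by omega)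

end

end Geometry

lemma generates_presentedGroup {α : Type} (rels : Set (FreeGroup α)) :
    Generates fun x : α => (PresentedGroup.of x : PresentedGroup rels) := by
  intro g
  refine exists_eval_of_mem_closure ?_
  have h := PresentedGroup.closure_range_of rels
  rw [h]
  trivial

namespace MHNNData

variable (D : MHNNData)

lemma generates_genA : Generates D.genA := generates_presentedGroup D.R

lemma generates_genG : Generates D.genG := generates_presentedGroup D.relsG

/-- The stable letters of `G`. -/
def stab (i : Fin D.n) : D.G := D.genG (Sum.inr i)

/-- The canonical projection onto `G`. -/
def projG : FreeGroup (D.X ⊕ Fin D.n) →* D.G := PresentedGroup.mk D.relsG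

lemma projG_of (y : D.X ⊕ Fin D.n) : D.projG (FreeGroup.of y) = D.genG y := rfl

lemma projA_of (x : D.X) : D.projA (FreeGroup.of x) = D.genA x := rfl

lemma projA_surjective : Function.Surjective D.projA := PresentedGroup.mk_surjective D.R

lemma projG_eq_one {r : FreeGroup (D.X ⊕ Fin D.n)} (hr : r ∈ D.relsG) : D.projG r = 1 :=
  PresentedGroup.one_of_mem hr

/-- A homomorphism out of the base group. -/
def liftA {H : Type*} [Group H] (f : FreeGroup D.X →* H) (hf : ∀ r ∈ D.R, f r = 1) : D.A →* H :=
  PresentedGroup.toGroup (rels := D.R) (f := fun x => f (FreeGroup.of x)) fun r hr => by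
    rw [show FreeGroup.lift (fun x => f (FreeGroup.of x)) = f by ext; simp]
    exact hf r hr

lemma liftA_projA {H : Type*} [Group H] (f : FreeGroup D.X →* H) (hf : ∀ r ∈ D.R, f r = 1)
    (w : FreeGroup D.X) : D.liftA f hf (D.projA w) = f w := by
  have h : (D.liftA f hf).comp D.projA = f := by
    ext x
    rw [MonoidHom.comp_apply, projA_of]
    unfold liftA genA
    exact PresentedGroup.toGroup.of _
  exact DFunLike.congr_fun h w

/-- The canonical map from the base group to `G`. -/
def incl : D.A →* D.G :=
  D.liftA (D.projG.comp (FreeGroup.map Sum.inl)) fun r hr =>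
    D.projG_eq_one (Or.inl ⟨r, hr, rfl⟩)

lemma incl_projA (w : FreeGroup D.X) : D.incl (D.projA w) = D.projG (FreeGroup.map Sum.inl w) :=
  D.liftA_projA _ _ w

lemma incl_genA (x : D.X) : D.incl (D.genA x) = D.genG (Sum.inl x) := by
  rw [← projA_of, incl_projA, FreeGroup.map.of, projG_of]

lemma stab_conj (i : Fin D.n) (k : Fin (D.m i)) :
    D.stab i * D.incl (D.v i k) * (D.stab i)⁻¹ = D.incl (D.u i k) := by
  have h := D.projG_eq_one (Or.inr ⟨i, k, rfl⟩)
  simp only [map_mul, map_inv, ← incl_projA, projG_of] at h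
  change (D.stab i)⁻¹ * D.incl (D.u i k) * D.stab i * (D.incl (D.v i k))⁻¹ = 1 at h
  rw [mul_inv_eq_one] at h
  rw [← h]
  group

/-- The subgroup of elements which the stable letter `σ` conjugates into the base group. -/
def sub : Fin D.n ⊕ Fin D.n → Subgroup D.A := Sum.elim D.V D.U

variable {D}

lemma exists_assocEquiv (h : D.FreeBases) (i : Fin D.n) :
    ∃ φ : D.V i ≃* D.U i, ∀ k (hk : D.v i k ∈ D.V i), (φ ⟨D.v i k, hk⟩ : D.A) = D.u i k := by
  have e : ∀ f : Fin (D.m i) → D.A, Function.Injective (FreeGroup.lift f) →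
      ∃ ψ : FreeGroup (Fin (D.m i)) ≃* Subgroup.closure (Set.range f),
        ∀ k, (ψ (FreeGroup.of k) : D.A) = f k := by
    intro f hf
    refine ⟨(MonoidHom.ofInjective hf).trans
      (MulEquiv.subgroupCongr FreeGroup.range_lift_eq_closure), fun k => ?_⟩
    simp [MonoidHom.ofInjective_apply]
  obtain ⟨ψ, hψ⟩ : ∃ ψ : _ ≃* D.U i, ∀ k, (ψ (FreeGroup.of k) : D.A) = D.u i k := e _ (h i).1
  obtain ⟨χ, hχ⟩ : ∃ χ : _ ≃* D.V i, ∀ k, (χ (FreeGroup.of k) : D.A) = D.v i k := e _ (h i).2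
  refine ⟨χ.symm.trans ψ, fun k hk => ?_⟩
  rw [← hψ k, MulEquiv.trans_apply]
  congr 2
  rw [MulEquiv.symm_apply_eq]
  exact Subtype.ext (hχ k).symm

/-- `G` maps to a group in which the base group embeds and Britton's lemma holds. -/
lemma exists_model (h : D.FreeBases) :
    ∃ (Γ : Type) (_ : Group Γ) (f : D.A →* Γ) (s : Fin D.n → Γ) (ρ : D.G →* Γ),
      Function.Injective f ∧ ρ.comp D.incl = f ∧
      (∀ σ, ρ (letterEval D.stab σ) = letterEval s σ) ∧
      ∀ a l, BrittonReduced D.sub l → hnnProd f s a l ∈ f.range → l = [] := by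
  choose φ hφ using exists_assocEquiv h
  obtain ⟨Γ, _, f, s, hf, hs, hb⟩ := hasBritton D.A (Fin D.n) D.U D.V φ
  let ρ' : FreeGroup (D.X ⊕ Fin D.n) →* Γ :=
    FreeGroup.lift (Sum.elim (fun x => f (D.genA x)) s)
  have hρ' : ∀ w, ρ' (FreeGroup.map Sum.inl w) = f (D.projA w) := by
    intro w
    have : ρ'.comp (FreeGroup.map Sum.inl) = f.comp D.projA := by
      ext x
      simp [ρ', projA_of]
    exact DFunLike.congr_fun this w
  have hrel : ∀ r ∈ D.relsG, ρ' r = 1 := by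
    rintro r (⟨r, hr, rfl⟩ | ⟨i, k, rfl⟩)
    · rw [hρ', show D.projA r = 1 from PresentedGroup.one_of_mem hr, map_one]
    · simp only [map_mul, map_inv, hρ']
      change (ρ' _)⁻¹ * f (D.u i k) * ρ' _ * (f (D.v i k))⁻¹ = 1
      have hk : D.v i k ∈ D.V i := Subgroup.subset_closure ⟨k, rfl⟩
      rw [← hφ i k hk, ← hs]
      simp [ρ', mul_assoc]
  let ρ : D.G →* Γ := PresentedGroup.toGroup (rels := D.relsG) hrel
  have hgen : ∀ y, ρ (D.genG y) = Sum.elim (fun x => f (D.genA x)) s y := fun y =>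
    PresentedGroup.toGroup.of _
  have hincl : ρ.comp D.incl = f := by
    have hcomp : (ρ.comp D.incl).comp D.projA = f.comp D.projA := by
      ext x
      simp [projA_of, incl_genA, hgen]
    refine MonoidHom.ext fun a => ?_
    obtain ⟨w, rfl⟩ := D.projA_surjective a
    exact DFunLike.congr_fun hcomp w
  have hletter : ∀ σ, ρ (letterEval D.stab σ) = letterEval s σ := by
    rintro (i | i) <;> simp [letterEval, stab, hgen]
  exact ⟨Γ, inferInstance, f, s, ρ, hf, hincl, hletter, hb⟩

lemma incl_injective (h : D.FreeBases) : Function.Injective D.incl := by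
  obtain ⟨Γ, _, f, s, ρ, hf, rfl, -, -⟩ := exists_model h
  exact Function.Injective.of_comp hf

/-- **Britton's lemma** for the multiple HNN extension `G`. -/
theorem britton (h : D.FreeBases) {a : D.A} {l : List ((Fin D.n ⊕ Fin D.n) × D.A)}
    (hl : BrittonReduced D.sub l) (hmem : hnnProd D.incl D.stab a l ∈ D.incl.range) : l = [] := by
  obtain ⟨Γ, _, f, s, ρ, -, rfl, hletter, hb⟩ := exists_model h
  refine hb a l hl ?_
  obtain ⟨c, hc⟩ := hmem
  refine ⟨c, ?_⟩
  rw [MonoidHom.comp_apply, hc]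
  simp [hnnProd, Function.comp_def, hletter, map_list_prod]

lemma exists_strip (h : D.IsIsometric) (σ : Fin D.n ⊕ Fin D.n) :
    ∃ (r : ℕ) (f g : Fin r → D.A), D.sub σ = Subgroup.closure (Set.range f) ∧
      TGConcat D.genA (Set.range f) ∧ TGReducedGeodesic D.genA f ∧ TGReducedGeodesic D.genA g ∧
      (∀ i, wlen D.genA (f i) = wlen D.genA (g i)) ∧
      ∀ i, letterEval D.stab σ * D.incl (f i) * (letterEval D.stab σ)⁻¹ = D.incl (g i) := by
  obtain ⟨-, htg, hse⟩ := h
  rcases σ with i | i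
  · exact ⟨D.m i, D.v i, D.u i, rfl, (htg i).2.1, (htg i).2.2, (htg i).1.2,
      fun k => (hse i k).symm, fun k => D.stab_conj i k⟩
  · refine ⟨D.m i, D.u i, D.v i, rfl, (htg i).1.1, (htg i).1.2, (htg i).2.2,
      fun k => hse i k, fun k => ?_⟩
    rw [← D.stab_conj i k]
    simp [letterEval, mul_assoc]

lemma exists_conj_of_mem_sub (h : D.IsIsometric) {σ : Fin D.n ⊕ Fin D.n} {a : D.A}
    (ha : a ∈ D.sub σ) : ∃ b, wlen D.genA b = wlen D.genA a ∧
      letterEval D.stab σ * D.incl a * (letterEval D.stab σ)⁻¹ = D.incl b := by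
  obtain ⟨r, f, g, hsub, -, hf, hg, hfg, hc⟩ := exists_strip h σ
  rw [hsub] at ha
  obtain ⟨l, rfl, hl⟩ := exists_freelyReduced ha
  refine ⟨eval g l, (hf.wlen_eq hg hfg hl).symm, ?_⟩
  clear hl ha
  induction l with
  | nil => simp
  | cons y l ih =>
    have hy : letterEval D.stab σ * D.incl (letterEval f y) * (letterEval D.stab σ)⁻¹ =
        D.incl (letterEval g y) := by
      rcases y with y | y
      · exact hc y
      · change _ * D.incl (f y)⁻¹ * _ = D.incl (g y)⁻¹
        rw [map_inv, map_inv, ← hc]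
        group
    rw [eval_cons, eval_cons, map_mul, map_mul, ← hy, ← ih]
    group

lemma exists_mirror_of_mem_sub (h : D.IsIsometric) : ∃ R, ∀ (σ : Fin D.n ⊕ Fin D.n)
    (W : List (D.X ⊕ D.X)), IsGeodesic D.genA W → eval D.genA W ∈ D.sub σ →
      ∃ V, Mirror D.genA D.incl (letterEval D.stab σ) R W V := by
  choose r f g hsub htg _ _ hfg hc using exists_strip h
  refine ⟨Finset.univ.sup fun σ => Finset.univ.sup fun k => wlen D.genA (f σ k),
    fun σ W hW hm => ?_⟩
  rw [hsub] at hm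
  refine exists_mirror D.generates_genA (htg σ) (hfg σ) (hc σ) (fun k => ?_) hW hm
  exact (Finset.le_sup (f := fun k => wlen D.genA (f σ k)) (Finset.mem_univ k)).trans
    (Finset.le_sup (f := fun σ => Finset.univ.sup fun k => wlen D.genA (f σ k))
      (Finset.mem_univ σ))

/-- Read a word over `X` as a word over the generators of `G`. -/
def baseWord (a : List (D.X ⊕ D.X)) : List ((D.X ⊕ Fin D.n) ⊕ (D.X ⊕ Fin D.n)) :=
  a.map (Sum.map Sum.inl Sum.inl)

/-- Read a stable letter as a letter over the generators of `G`. -/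
def stabLetter (σ : Fin D.n ⊕ Fin D.n) : (D.X ⊕ Fin D.n) ⊕ (D.X ⊕ Fin D.n) :=
  Sum.map Sum.inr Sum.inr σ

/-- The word `σ₁ a₁ σ₂ a₂ ⋯` over the generators of `G`. -/
def syllables (l : List ((Fin D.n ⊕ Fin D.n) × List (D.X ⊕ D.X))) :
    List ((D.X ⊕ Fin D.n) ⊕ (D.X ⊕ Fin D.n)) :=
  l.flatMap fun p => stabLetter p.1 :: baseWord p.2

/-- Evaluate the base words in a list of syllables. -/
def evalSyllables (l : List ((Fin D.n ⊕ Fin D.n) × List (D.X ⊕ D.X))) :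
    List ((Fin D.n ⊕ Fin D.n) × D.A) :=
  l.map (Prod.map id (eval D.genA))

@[simp] lemma letterEval_stabLetter (σ : Fin D.n ⊕ Fin D.n) :
    letterEval D.genG (stabLetter σ) = letterEval D.stab σ := by
  rcases σ with i | i <;> rfl

@[simp] lemma stabLetter_swap (σ : Fin D.n ⊕ Fin D.n) :
    (stabLetter σ).swap = stabLetter (D := D) σ.swap := by
  rcases σ with i | i <;> rfl

@[simp] lemma length_baseWord (a : List (D.X ⊕ D.X)) : (baseWord a).length = a.length := by
  simp [baseWord]

@[simp] lemma baseWord_append (a b : List (D.X ⊕ D.X)) :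
    baseWord (a ++ b) = baseWord a ++ baseWord b := by
  simp [baseWord]

@[simp] lemma baseWord_nil : baseWord (D := D) [] = [] := rfl

@[simp] lemma winv_baseWord (a : List (D.X ⊕ D.X)) : winv (baseWord a) = baseWord (winv a) := by
  simp only [winv, baseWord, List.map_reverse, List.map_map]
  congr 2
  funext x
  rcases x with x | x <;> rfl

@[simp] lemma eval_baseWord (a : List (D.X ⊕ D.X)) :
    eval D.genG (baseWord a) = D.incl (eval D.genA a) := by
  induction a with
  | nil => simp
  | cons x a ih =>
    change eval D.genG (_ :: baseWord a) = _
    rw [eval_cons, eval_cons, ih, map_mul]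
    congr 1
    rcases x with x | x <;> simp [letterEval, incl_genA]

@[simp] lemma syllables_nil : syllables (D := D) [] = [] := rfl

@[simp] lemma syllables_cons (σ : Fin D.n ⊕ Fin D.n) (b : List (D.X ⊕ D.X))
    (l : List ((Fin D.n ⊕ Fin D.n) × List (D.X ⊕ D.X))) :
    syllables ((σ, b) :: l) = stabLetter σ :: (baseWord b ++ syllables l) := by
  simp [syllables]

@[simp] lemma syllables_append (l l' : List ((Fin D.n ⊕ Fin D.n) × List (D.X ⊕ D.X))) :
    syllables (l ++ l') = syllables l ++ syllables l' := by
  simp [syllables]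

lemma wlen_incl_le (a : D.A) : wlen D.genG (D.incl a) ≤ wlen D.genA a := by
  obtain ⟨w, rfl, hw⟩ := exists_word_of_generates (D.generates_genA a)
  rw [← hw, ← eval_baseWord, ← length_baseWord w]
  exact wlen_eval_le _

lemma isGeodesic_of_baseWord {a : List (D.X ⊕ D.X)} (h : IsGeodesic D.genG (baseWord a)) :
    IsGeodesic D.genA a := by
  rw [isGeodesic_iff] at h ⊢
  intro b hb
  simpa using h (baseWord b) (by simp [hb])

lemma exists_syllables (w : List ((D.X ⊕ Fin D.n) ⊕ (D.X ⊕ Fin D.n))) :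
    ∃ a l, w = baseWord a ++ syllables l := by
  induction w with
  | nil => exact ⟨[], [], rfl⟩
  | cons y w ih =>
    obtain ⟨a, l, rfl⟩ := ih
    rcases y with (x | i) | (x | i)
    · exact ⟨Sum.inl x :: a, l, rfl⟩
    · exact ⟨[], (Sum.inl i, a) :: l, by simp [stabLetter]⟩
    · exact ⟨Sum.inr x :: a, l, rfl⟩
    · exact ⟨[], (Sum.inr i, a) :: l, by simp [stabLetter]⟩

lemma eval_syllables (a : List (D.X ⊕ D.X))
    (l : List ((Fin D.n ⊕ Fin D.n) × List (D.X ⊕ D.X))) :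
    eval D.genG (baseWord a ++ syllables l) =
      hnnProd D.incl D.stab (eval D.genA a) (evalSyllables l) := by
  induction l generalizing a with
  | nil => simp [evalSyllables]
  | cons p l ih =>
    obtain ⟨σ, b⟩ := p
    have := ih b
    simp only [evalSyllables, eval_append, eval_baseWord, List.map_cons, hnnProd_cons,
      syllables_cons, eval_cons, letterEval_stabLetter, Prod.map_fst, Prod.map_snd, id] at this ⊢
    rw [this, mul_assoc]

lemma brittonReduced_of_isGeodesic (h : D.IsIsometric) {a : List (D.X ⊕ D.X)}
    {l : List ((Fin D.n ⊕ Fin D.n) × List (D.X ⊕ D.X))}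
    (hg : IsGeodesic D.genG (baseWord a ++ syllables l)) :
    BrittonReduced D.sub (evalSyllables l) := by
  rw [BrittonReduced, evalSyllables, List.isChain_map, List.isChain_iff_forall_rel_of_append_cons_cons]
  rintro ⟨σ, b⟩ ⟨τ, b'⟩ l₁ l₂ rfl ⟨hτ, hb⟩
  obtain rfl : τ = σ.swap := hτ
  obtain ⟨c, hc, hcb⟩ := exists_conj_of_mem_sub h hb
  obtain ⟨c, rfl, hc'⟩ := exists_word_of_generates (D.generates_genA c)
  rw [isGeodesic_iff] at hg
  have h1 := hg (baseWord a ++ syllables l₁ ++ baseWord c ++ baseWord b' ++ syllables l₂) (by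
    simp [← hcb, mul_assoc])
  have h2 : wlen D.genA (eval D.genA b) ≤ b.length := wlen_eval_le b
  simp only [List.length_append, syllables_append, syllables_cons, List.length_cons,
    length_baseWord] at h1
  simp only [Prod.map_snd] at hc
  omega

lemma eq_nil_of_isGeodesic (h : D.IsIsometric) {a b : List (D.X ⊕ D.X)}
    {l : List ((Fin D.n ⊕ Fin D.n) × List (D.X ⊕ D.X))}
    (hg : IsGeodesic D.genG (baseWord b ++ syllables l))
    (he : eval D.genG (baseWord a) = eval D.genG (baseWord b ++ syllables l)) : l = [] := by
  have h1 := britton h.1 (a := eval D.genA b) (brittonReduced_of_isGeodesic h hg)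
    ⟨eval D.genA a, by rw [← eval_syllables, ← he, eval_baseWord]⟩
  simpa [evalSyllables] using h1

/-- The last stable letters of two geodesics with the same endpoints agree, and the two strips
which they start are crossed by the path between them. -/
lemma last_stable_eq (h : D.IsIsometric) {a a' b b' : List (D.X ⊕ D.X)}
    {l l' : List ((Fin D.n ⊕ Fin D.n) × List (D.X ⊕ D.X))} {σ σ' : Fin D.n ⊕ Fin D.n}
    (hg : IsGeodesic D.genG (baseWord a ++ syllables (l ++ [(σ, b)])))
    (hg' : IsGeodesic D.genG (baseWord a' ++ syllables (l' ++ [(σ', b')])))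
    (he : eval D.genG (baseWord a ++ syllables (l ++ [(σ, b)])) =
      eval D.genG (baseWord a' ++ syllables (l' ++ [(σ', b')]))) :
    σ' = σ ∧ eval D.genA b * (eval D.genA b')⁻¹ ∈ D.sub σ := by
  by_contra hne
  obtain ⟨c, m, hcm⟩ := exists_syllables (winv (baseWord a' ++ syllables l'))
  have hinv : winv (baseWord a' ++ syllables (l' ++ [(σ', b')])) =
      baseWord (winv b') ++ syllables ((σ'.swap, c) :: m) := by
    rw [syllables_append, ← List.append_assoc, winv_append, hcm, syllables_cons, winv_cons,
      syllables_cons]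
    simp
  have hr := brittonReduced_of_isGeodesic h hg
  have hr' := brittonReduced_of_isGeodesic h (hinv ▸ hg'.winv)
  have hred : BrittonReduced D.sub (evalSyllables l ++
      (σ, eval D.genA b * (eval D.genA b')⁻¹) :: evalSyllables ((σ'.swap, c) :: m)) := by
    simp only [BrittonReduced, evalSyllables, List.map_append, List.map_cons, List.map_nil,
      List.isChain_append, List.isChain_cons_cons] at hr hr' ⊢
    refine ⟨hr.1, ⟨?_, hr'⟩, ?_⟩
    · rintro ⟨h1, h2⟩
      exact hne ⟨by simpa using congrArg Sum.swap h1, h2⟩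
    · intro x hx y hy
      have := hr.2.2 x hx _ rfl
      simp only [List.head?_cons, Option.mem_some_iff] at hy
      subst hy
      exact this
  have hprod : hnnProd D.incl D.stab (eval D.genA a) (evalSyllables l ++
      (σ, eval D.genA b * (eval D.genA b')⁻¹) :: evalSyllables ((σ'.swap, c) :: m)) = 1 := by
    have h1 : eval D.genG (baseWord a ++ syllables (l ++ [(σ, b)])) *
        eval D.genG (baseWord (winv b') ++ syllables ((σ'.swap, c) :: m)) = 1 := by
      rw [← hinv, eval_winv, he, mul_inv_cancel]
    rw [eval_syllables, eval_syllables] at h1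
    rw [← h1]
    simp [hnnProd, evalSyllables, mul_assoc]
  have h2 := britton h.1 hred (hprod ▸ one_mem _)
  simp at h2

/-- The case in which the last letters of both geodesics lie in the base group. -/
lemma conn_of_base {k R N : ℕ} (hk : SynchFFTP D.genA k) {p p' : D.G} {n n' : ℕ}
    (hp : wlen D.genG p ≤ n) (hp' : wlen D.genG p' ≤ n')
    {b b' : List (D.X ⊕ D.X)} {x x' : D.X ⊕ D.X}
    (hl : n + b.length = N) (hl' : n' + b'.length = N)
    (he : p * D.incl (eval D.genA (b ++ [x])) = p' * D.incl (eval D.genA (b' ++ [x'])))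
    (hR : ∀ W : List (D.X ⊕ D.X), IsGeodesic D.genA W →
      eval D.genA W = eval D.genA (b ++ [x]) * (eval D.genA (b' ++ [x']))⁻¹ →
      W = [] ∨ ∃ P c V, p = P * c ∧ wlen D.genG c ≤ 1 ∧ wlen D.genG P + 1 ≤ n ∧
        wlen D.genG (p' * c⁻¹) + 1 ≤ n' ∧ Mirror D.genA D.incl c R W V) :
    Conn D.genG N (12 * k + 4 * R + 6) (p * D.incl (eval D.genA b))
      (p' * D.incl (eval D.genA b')) := by
  set W := (b ++ [x]) ++ winv (b' ++ [x']) with hW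
  have hWe : eval D.genA W = eval D.genA (b ++ [x]) * (eval D.genA (b' ++ [x']))⁻¹ := by
    rw [hW, eval_append, eval_winv]
  have hWl : W.length = (b.length + 1) + (b'.length + 1) := by
    rw [hW, List.length_append, length_winv]
    simp
  have hend : p * D.incl (eval D.genA W) = p' := by
    rw [hWe, map_mul, map_inv, ← mul_assoc, he]
    group
  have hstart : pos D.genA W (b.length + 1 - 1) = eval D.genA b := by
    rw [hW, pos_append_left (by simp), pos_append_left (by simp), pos_of_length_le (by simp)]
  have hfinish : p * D.incl (pos D.genA W (b.length + 1 + 1)) = p' * D.incl (eval D.genA b') := by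
    have h1 : pos D.genA W (b.length + 1 + 1) =
        eval D.genA (b ++ [x]) * (letterEval D.genA x')⁻¹ := by
      rw [hW, winv_append, show b.length + 1 + 1 = (b ++ [x]).length + 1 by simp, pos_append_add]
      simp [pos, winv]
    rw [h1, map_mul, ← mul_assoc, he]
    simp [mul_assoc]
  obtain ⟨W', he', hle, hf, hcase⟩ := hk.exists_fellow D.generates_genA W
  rw [← hstart, ← hfinish]
  have hshort : W'.length + 2 ≤ W.length → Conn D.genG N (12 * k + 4 * R + 6)
      (p * D.incl (pos D.genA W (b.length + 1 - 1)))
      (p * D.incl (pos D.genA W (b.length + 1 + 1))) := fun hs =>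
    (conn_of_shorter D.generates_genG wlen_incl_le he' hWl (by omega) hf hp (hend ▸ hp')
      (by omega) (by omega) (by omega) (by omega)).mono (by omega)
  rcases hcase with hs | ⟨hg, hs⟩
  · exact hshort hs
  rcases hR W' hg (he'.trans hWe) with rfl | ⟨P, c, V, rfl, hc, hP, hP', hV⟩
  · exact hshort (by simp only [List.length_nil]; omega)
  · exact (conn_of_mirror D.generates_genG wlen_incl_le hV hc he' hWl hle (by omega) hf hp hP
      (hend ▸ hp') (by rwa [hend]) (by omega) (by omega) (by omega) (by omega)).mono (by omega)

/-- The case in which just one of the geodesics ends in a stable letter. -/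
lemma conn_of_base_of_stable (h : D.IsIsometric) {R N : ℕ}
    (hR : ∀ (σ : Fin D.n ⊕ Fin D.n) (W : List (D.X ⊕ D.X)), IsGeodesic D.genA W →
      eval D.genA W ∈ D.sub σ → ∃ V, Mirror D.genA D.incl (letterEval D.stab σ) R W V)
    {a a' : List (D.X ⊕ D.X)} {l l' : List ((Fin D.n ⊕ Fin D.n) × List (D.X ⊕ D.X))}
    {x : D.X ⊕ D.X} {σ : Fin D.n ⊕ Fin D.n}
    (hN : (baseWord a ++ syllables l).length = N)
    (hg : IsGeodesic D.genG (baseWord a ++ syllables l ++ baseWord [x]))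
    (hg' : IsGeodesic D.genG (baseWord a' ++ syllables l' ++ [stabLetter σ]))
    (he : eval D.genG (baseWord a ++ syllables l ++ baseWord [x]) =
      eval D.genG (baseWord a' ++ syllables l' ++ [stabLetter σ])) :
    Conn D.genG N (2 * R + 2) (eval D.genG (baseWord a ++ syllables l))
      (eval D.genG (baseWord a' ++ syllables l')) := by
  have hw' : baseWord a' ++ syllables l' ++ [stabLetter σ] =
      baseWord a' ++ syllables (l' ++ [(σ, [])]) := by simp
  rcases List.eq_nil_or_concat' l with rfl | ⟨l, ⟨τ, b⟩, rfl⟩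
  · exfalso
    have h1 := eq_nil_of_isGeodesic h (a := a ++ [x]) (hw' ▸ hg') (by rw [← hw', ← he]; simp)
    simp at h1
  have hw : baseWord a ++ syllables (l ++ [(τ, b)]) ++ baseWord [x] =
      baseWord a ++ syllables (l ++ [(τ, b ++ [x])]) := by simp
  obtain ⟨rfl, hm⟩ := last_stable_eq h (hw ▸ hg) (hw' ▸ hg') (by rw [← hw, ← hw', he])
  have hgb : IsGeodesic D.genG (baseWord (b ++ [x])) := by
    refine IsGeodesic.right (a := baseWord a ++ syllables l ++ [stabLetter σ]) ?_
    simpa using hg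
  have hP := wlen_eval_le (gen := D.genG) (baseWord a ++ syllables l)
  have hσ : wlen D.genG (letterEval D.stab σ) ≤ 1 := by
    rw [← letterEval_stabLetter]
    exact wlen_letterEval_le _
  have hmul := wlen_mul_le D.generates_genG (eval D.genG (baseWord a ++ syllables l))
    (letterEval D.stab σ)
  obtain ⟨V, hV⟩ := hR σ _ (isGeodesic_of_baseWord hgb) (by simpa using hm)
  have key := conn_of_mirror_end D.generates_genG wlen_incl_le (N := N)
    (p := eval D.genG (baseWord a ++ syllables l))
    (n₀ := (baseWord a ++ syllables l).length + 1) (L := b.length + 1) hV hσ (by simp)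
    (by omega) (by omega) (by omega) (by
      rw [← hN]
      simp
      omega)
  have e1 : pos D.genA (b ++ [x]) (b.length + 1 - 1) = eval D.genA b := by
    rw [pos_append_left (by simp), pos_of_length_le (by simp)]
  have e2 : eval D.genG (baseWord a ++ syllables l) * letterEval D.stab σ *
      D.incl (eval D.genA (b ++ [x])) * (letterEval D.stab σ)⁻¹ =
      eval D.genG (baseWord a' ++ syllables l') := by
    rw [mul_inv_eq_iff_eq_mul, ← eval_baseWord]
    simpa [mul_assoc] using he
  rw [e1, e2] at key
  simpa [mul_assoc] using key

/-- The case in which both geodesics end in a letter of the base group. -/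
lemma conn_of_base_of_base (h : D.IsIsometric) {k R N : ℕ} (hk : SynchFFTP D.genA k)
    (hR : ∀ (σ : Fin D.n ⊕ Fin D.n) (W : List (D.X ⊕ D.X)), IsGeodesic D.genA W →
      eval D.genA W ∈ D.sub σ → ∃ V, Mirror D.genA D.incl (letterEval D.stab σ) R W V)
    {a a' : List (D.X ⊕ D.X)} {l l' : List ((Fin D.n ⊕ Fin D.n) × List (D.X ⊕ D.X))}
    {x x' : D.X ⊕ D.X}
    (hN : (baseWord a ++ syllables l).length = N)
    (hN' : (baseWord a' ++ syllables l').length = N)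
    (hg : IsGeodesic D.genG (baseWord a ++ syllables l ++ baseWord [x]))
    (hg' : IsGeodesic D.genG (baseWord a' ++ syllables l' ++ baseWord [x']))
    (he : eval D.genG (baseWord a ++ syllables l ++ baseWord [x]) =
      eval D.genG (baseWord a' ++ syllables l' ++ baseWord [x'])) :
    Conn D.genG N (12 * k + 4 * R + 6) (eval D.genG (baseWord a ++ syllables l))
      (eval D.genG (baseWord a' ++ syllables l')) := by
  rcases List.eq_nil_or_concat' l with rfl | ⟨l, ⟨σ, b⟩, rfl⟩ <;>
    rcases List.eq_nil_or_concat' l' with rfl | ⟨l', ⟨σ', b'⟩, rfl⟩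
  · have he' : eval D.genA (a ++ [x]) = eval D.genA (a' ++ [x']) := by
      refine incl_injective h.1 ?_
      rw [← eval_baseWord, ← eval_baseWord]
      simpa using he
    have key := conn_of_base (R := R) (N := N) hk (p := 1) (p' := 1) (n := 0) (n' := 0)
      (b := a) (b' := a') (x := x) (x' := x') (by simp) (by simp) (by simpa using hN)
      (by simpa using hN') (by rw [he']) ?_
    · simpa using key
    · intro W hW heW
      rw [he', mul_inv_cancel] at heW
      refine Or.inl (List.eq_nil_of_length_eq_zero ?_)
      rw [hW, heW, wlen_one]
  · exfalso
    have hw' : baseWord a' ++ syllables (l' ++ [(σ', b')]) ++ baseWord [x'] =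
        baseWord a' ++ syllables (l' ++ [(σ', b' ++ [x'])]) := by simp
    have h1 := eq_nil_of_isGeodesic h (a := a ++ [x]) (hw' ▸ hg') (by rw [← hw', ← he]; simp)
    simp at h1
  · exfalso
    have hw : baseWord a ++ syllables (l ++ [(σ, b)]) ++ baseWord [x] =
        baseWord a ++ syllables (l ++ [(σ, b ++ [x])]) := by simp
    have h1 := eq_nil_of_isGeodesic h (a := a' ++ [x']) (hw ▸ hg) (by rw [← hw, he]; simp)
    simp at h1
  · have hw : baseWord a ++ syllables (l ++ [(σ, b)]) ++ baseWord [x] =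
        baseWord a ++ syllables (l ++ [(σ, b ++ [x])]) := by simp
    have hw' : baseWord a' ++ syllables (l' ++ [(σ', b')]) ++ baseWord [x'] =
        baseWord a' ++ syllables (l' ++ [(σ', b' ++ [x'])]) := by simp
    obtain ⟨rfl, hm⟩ := last_stable_eq h (hw ▸ hg) (hw' ▸ hg') (by rw [← hw, ← hw', he])
    have hP := wlen_eval_le (gen := D.genG) (baseWord a ++ syllables l)
    have hP' := wlen_eval_le (gen := D.genG) (baseWord a' ++ syllables l')
    have hσ : wlen D.genG (letterEval D.stab σ') ≤ 1 := by
      rw [← letterEval_stabLetter]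
      exact wlen_letterEval_le _
    have hmul := wlen_mul_le D.generates_genG (eval D.genG (baseWord a ++ syllables l))
      (letterEval D.stab σ')
    have hmul' := wlen_mul_le D.generates_genG (eval D.genG (baseWord a' ++ syllables l'))
      (letterEval D.stab σ')
    have key := conn_of_base (R := R) (N := N) hk
      (p := eval D.genG (baseWord a ++ syllables l) * letterEval D.stab σ')
      (p' := eval D.genG (baseWord a' ++ syllables l') * letterEval D.stab σ')
      (n := (baseWord a ++ syllables l).length + 1)
      (n' := (baseWord a' ++ syllables l').length + 1)
      (b := b) (b' := b') (x := x) (x' := x') (by omega) (by omega)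
      (by rw [← hN]; simp; omega) (by rw [← hN']; simp; omega)
      (by rw [← eval_baseWord, ← eval_baseWord]; simpa [mul_assoc] using he) ?_
    · simpa [mul_assoc] using key
    · intro W hW heW
      obtain ⟨V, hV⟩ := hR σ' W hW (heW ▸ hm)
      exact Or.inr ⟨_, _, V, rfl, hσ, by omega, by rw [mul_inv_cancel_right]; omega, hV⟩

/-- Two geodesics with the same endpoint have penultimate vertices which are connected. -/
lemma conn_of_geodesics (h : D.IsIsometric) {k R N : ℕ} (hk : SynchFFTP D.genA k)
    (hR : ∀ (σ : Fin D.n ⊕ Fin D.n) (W : List (D.X ⊕ D.X)), IsGeodesic D.genA W →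
      eval D.genA W ∈ D.sub σ → ∃ V, Mirror D.genA D.incl (letterEval D.stab σ) R W V)
    {w w' : List ((D.X ⊕ Fin D.n) ⊕ (D.X ⊕ Fin D.n))} {y y' : (D.X ⊕ Fin D.n) ⊕ (D.X ⊕ Fin D.n)}
    (hN : w.length = N) (hN' : w'.length = N)
    (hg : IsGeodesic D.genG (w ++ [y])) (hg' : IsGeodesic D.genG (w' ++ [y']))
    (he : eval D.genG (w ++ [y]) = eval D.genG (w' ++ [y'])) :
    Conn D.genG N (12 * k + 4 * R + 6) (eval D.genG w) (eval D.genG w') := by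
  have hletter : ∀ y : (D.X ⊕ Fin D.n) ⊕ (D.X ⊕ Fin D.n),
      (∃ x, [y] = baseWord [x]) ∨ ∃ σ, y = stabLetter σ := by
    rintro ((x | i) | (x | i))
    · exact Or.inl ⟨Sum.inl x, rfl⟩
    · exact Or.inr ⟨Sum.inl i, rfl⟩
    · exact Or.inl ⟨Sum.inr x, rfl⟩
    · exact Or.inr ⟨Sum.inr i, rfl⟩
  obtain ⟨a, l, rfl⟩ := exists_syllables w
  obtain ⟨a', l', rfl⟩ := exists_syllables w'
  rcases hletter y with ⟨x, hx⟩ | ⟨σ, rfl⟩ <;> rcases hletter y' with ⟨x', hx'⟩ | ⟨σ', rfl⟩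
  · rw [hx] at hg he
    rw [hx'] at hg' he
    exact conn_of_base_of_base h hk hR hN hN' hg hg' he
  · rw [hx] at hg he
    exact (conn_of_base_of_stable h hR hN hg hg' he).mono (by omega)
  · rw [hx'] at hg' he
    exact (conn_of_base_of_stable h hR hN' hg' hg he.symm).symm.mono (by omega)
  · have hw : ∀ (a : List (D.X ⊕ D.X)) l (σ : Fin D.n ⊕ Fin D.n),
        baseWord a ++ syllables l ++ [stabLetter σ] =
          baseWord a ++ syllables (l ++ [(σ, [])]) := by simp
    obtain ⟨rfl, -⟩ := last_stable_eq h (hw .. ▸ hg) (hw .. ▸ hg') (by rw [← hw, ← hw, he])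
    have heq : eval D.genG (baseWord a ++ syllables l) =
        eval D.genG (baseWord a' ++ syllables l') := by
      rw [eval_append _ [_], eval_append _ [_]] at he
      exact mul_right_cancel he
    rw [← heq]
    exact (Conn.refl ((wlen_eval_le _).trans hN.le)).mono (by omega)

end MHNNData

open MHNNData in
/-- An isometric multiple HNN extension of a finitely presented base group
`(A,X)` having the synchronous falsification by fellow traveler property is almost convex
with respect to the generating set `X ∪ {s_1, …, s_n}`. -/
theorem isometric_mhnn_almostConvex (D : MHNNData) (hfp : D.R.Finite)
    (hiso : D.IsIsometric)
    (hfftp : ∃ k : ℕ, 0 < k ∧ SynchFFTP D.genA k) :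
    AlmostConvex D.genG := by
  obtain ⟨k, -, hk⟩ := hfftp
  obtain ⟨R, hR⟩ := exists_mirror_of_mem_sub hiso
  have hgen := D.generates_genG
  refine ⟨12 * k + 4 * R + 6, by omega, fun N _ g g' hg hg' hd => ?_⟩
  change Conn D.genG N (12 * k + 4 * R + 6) g g'
  obtain ⟨q, hq, hql⟩ := exists_word_of_generates (hgen (g⁻¹ * g'))
  obtain rfl : g' = g * eval D.genG q := by rw [hq, mul_inv_cancel_left]
  rw [← hql] at hd
  rcases q with _ | ⟨y, _ | ⟨y', _ | ⟨_, _⟩⟩⟩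
  · simpa using (Conn.refl hg.le).mono (Nat.zero_le _)
  · simpa using (Conn.letter (y := y) hg.le (by simpa using hg'.le)).mono (by omega)
  · simp only [eval_cons, eval_nil, mul_one, ← mul_assoc] at hg' ⊢
    by_cases hN : wlen D.genG (g * letterEval D.genG y) ≤ N
    · exact ((Conn.letter hg.le hN).trans (Conn.letter hN hg'.le)).mono (by omega)
    obtain ⟨w, rfl, hw⟩ := exists_word_of_generates (hgen g)
    obtain ⟨w', hw', hwl⟩ := exists_word_of_generates
      (hgen (eval D.genG w * letterEval D.genG y * letterEval D.genG y'))
    have he : eval D.genG (w ++ [y]) = eval D.genG (w' ++ [y'.swap]) := by simp [hw']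
    have h1 := wlen_eval_le (gen := D.genG) (w ++ [y])
    have h2 : wlen D.genG (eval D.genG (w ++ [y])) =
        wlen D.genG (eval D.genG w * letterEval D.genG y) := by simp
    rw [List.length_append, List.length_singleton] at h1
    rw [← hw']
    refine conn_of_geodesics hiso hk hR (hw.trans hg) (hwl.trans hg') ?_ ?_ he
    · rw [IsGeodesic, List.length_append, List.length_singleton]
      omega
    · rw [IsGeodesic, ← he, List.length_append, List.length_singleton]
      omega
  · simp at hd

end ACPaper
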